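/- For any quantum relative entropy 𝐃 and density matrices ρ, ω, σ on ℂ^d with σ > 0 and λ_min(ω) > ‖ρ − ω‖_∞, one has 𝐃(ρ∥σ) − 𝐃(ω∥σ) ≤ log₂(1 + ‖ρ − ω‖_∞ / (λ_min(ω) · λ_min(σ))). -/

import Mathlib

open scoped ENNReal Kronecker ComplexOrder Matrix
open Classical

/-- A density matrix: positive semidefinite with unit trace. -/
def IsDensity {n : Type} [Fintype n] (ρ : Matrix n n ℂ) : Prop :=
  ρ.PosSemidef ∧ ρ.trace = 1

/-- The extension `id_m ⊗ Φ` of a map `Φ` on matrices, acting blockwise. -/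
def cpExt {a b : Type} (Φ : Matrix a a ℂ → Matrix b b ℂ) (m : Type)
    (M : Matrix (m × a) (m × a) ℂ) : Matrix (m × b) (m × b) ℂ :=
  Matrix.of fun p q => Φ (Matrix.of fun k l => M (p.1, k) (q.1, l)) p.2 q.2

/-- A map on matrices is completely positive if every extension `id_m ⊗ Φ`
preserves positive semidefiniteness. -/
def IsCP {a b : Type} [Fintype a] [Fintype b] (Φ : Matrix a a ℂ → Matrix b b ℂ) : Prop :=
  ∀ (m : Type) [Fintype m] (M : Matrix (m × a) (m × a) ℂ),
    M.PosSemidef → (cpExt Φ m M).PosSemidef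

/-- A quantum channel: a linear, completely positive, trace-preserving map. -/
def IsCPTP {a b : Type} [Fintype a] [Fintype b] (Φ : Matrix a a ℂ → Matrix b b ℂ) : Prop :=
  (∀ (c : ℂ) (A B : Matrix a a ℂ), Φ (c • A + B) = c • Φ A + Φ B) ∧
    IsCP Φ ∧ ∀ A : Matrix a a ℂ, (Φ A).trace = A.trace

/-- The projector onto the support of a Hermitian matrix. -/
noncomputable def suppProj {n : Type} [Fintype n] [DecidableEq n]
    (ρ : Matrix n n ℂ) : Matrix n n ℂ :=
  if h : ρ.IsHermitian then
    (h.eigenvectorUnitary : Matrix n n ℂ) *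
      Matrix.diagonal (fun i => if h.eigenvalues i = 0 then (0 : ℂ) else 1) *
      (h.eigenvectorUnitary : Matrix n n ℂ)ᴴ
  else 0

/-- The min relative entropy `D_min(ρ‖σ) = -log₂ Tr[Π_ρ σ]` (with value `+∞` if
`Tr[Π_ρ σ] = 0`, i.e. if `ρ ⊥ σ`). -/
noncomputable def Dmin {n : Type} [Fintype n] [DecidableEq n]
    (ρ σ : Matrix n n ℂ) : ℝ≥0∞ :=
  if ((suppProj ρ * σ).trace.re) = 0 then ∞
  else ENNReal.ofReal (- Real.logb 2 ((suppProj ρ * σ).trace.re))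

/-- The max relative entropy `D_max(ρ‖σ) = log₂ min {t : tσ ≥ ρ}` (with value `+∞`
if no such `t` exists, i.e. if `supp ρ ⊄ supp σ`). -/
noncomputable def Dmax {n : Type} [Fintype n]
    (ρ σ : Matrix n n ℂ) : ℝ≥0∞ :=
  if ∃ t : ℝ, ((t : ℂ) • σ - ρ).PosSemidef then
    ENNReal.ofReal (Real.logb 2 (sInf {t : ℝ | ((t : ℂ) • σ - ρ).PosSemidef}))
  else ∞

/-- The smallest eigenvalue of a Hermitian matrix (junk value `0` otherwise). -/
noncomputable def minEig {n : Type} [Fintype n] [DecidableEq n] (ω : Matrix n n ℂ) : ℝ :=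
  if h : ω.IsHermitian then ⨅ i, h.eigenvalues i else 0

/-- The operator norm of a Hermitian matrix, i.e. the largest absolute value of an
eigenvalue (junk value `0` otherwise). -/
noncomputable def hermOpNorm {n : Type} [Fintype n] [DecidableEq n] (X : Matrix n n ℂ) : ℝ :=
  if h : X.IsHermitian then ⨆ i, |h.eigenvalues i| else 0


section PosSemidefBounds

variable {n : Type} [Fintype n] [DecidableEq n]

/-- A real affine function of a Hermitian matrix is positive semidefinite if it is nonnegative
on the eigenvalues. -/
theorem posSemidef_smul_one_add_smul {A : Matrix n n ℂ} (hA : A.IsHermitian) {x y : ℝ}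
    (h : ∀ i, 0 ≤ x + y * hA.eigenvalues i) :
    ((x : ℂ) • (1 : Matrix n n ℂ) + (y : ℂ) • A).PosSemidef := by
  set U : Matrix n n ℂ := (hA.eigenvectorUnitary : Matrix n n ℂ) with hU
  have hUU : U * Uᴴ = 1 := Unitary.mul_star_self_of_mem hA.eigenvectorUnitary.2
  have hspec : A = U * Matrix.diagonal (fun i => (hA.eigenvalues i : ℂ)) * Uᴴ := by
    have h := hA.spectral_theorem
    rw [Unitary.conjStarAlgAut_apply] at h
    exact h
  have hdiag : (Matrix.diagonal
      (fun i => ((x + y * hA.eigenvalues i : ℝ) : ℂ))).PosSemidef :=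
    Matrix.PosSemidef.diagonal fun i => Complex.zero_le_real.2 (h i)
  have hd : Matrix.diagonal (fun i => ((x + y * hA.eigenvalues i : ℝ) : ℂ))
      = (x : ℂ) • (1 : Matrix n n ℂ)
        + (y : ℂ) • Matrix.diagonal (fun i => (hA.eigenvalues i : ℂ)) := by
    ext i j
    by_cases h : i = j <;> simp [h]
  have heq : (x : ℂ) • (1 : Matrix n n ℂ) + (y : ℂ) • A
      = U * Matrix.diagonal (fun i => ((x + y * hA.eigenvalues i : ℝ) : ℂ)) * Uᴴ := by
    rw [hd, mul_add, add_mul, Matrix.mul_smul, Matrix.smul_mul, mul_one, hUU, Matrix.mul_smul,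
      Matrix.smul_mul, ← hspec]
  rw [heq]
  exact hdiag.mul_mul_conjTranspose_same U

theorem posSemidef_sub_minEig {A : Matrix n n ℂ} (hA : A.IsHermitian) :
    (A - (minEig A : ℂ) • (1 : Matrix n n ℂ)).PosSemidef := by
  have h := posSemidef_smul_one_add_smul hA (x := -minEig A) (y := 1) fun i => by
    have h1 : minEig A ≤ hA.eigenvalues i := by
      rw [minEig, dif_pos hA]
      exact ciInf_le (Set.finite_range _).bddBelow i
    linarith
  convert h using 1
  push_cast
  module

theorem posSemidef_add_hermOpNorm {A : Matrix n n ℂ} (hA : A.IsHermitian) :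
    (A + (hermOpNorm A : ℂ) • (1 : Matrix n n ℂ)).PosSemidef := by
  have h := posSemidef_smul_one_add_smul hA (x := hermOpNorm A) (y := 1) fun i => by
    have h1 : |hA.eigenvalues i| ≤ hermOpNorm A := by
      rw [hermOpNorm, dif_pos hA]
      exact le_ciSup (f := fun i => |hA.eigenvalues i|) (Set.finite_range _).bddAbove i
    linarith [neg_abs_le (hA.eigenvalues i)]
  convert h using 1
  push_cast
  module

theorem hermOpNorm_nonneg (A : Matrix n n ℂ) : 0 ≤ hermOpNorm A := by
  rw [hermOpNorm]
  split_ifs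
  · exact Real.iSup_nonneg fun i => abs_nonneg _
  · exact le_rfl

theorem eq_zero_of_hermOpNorm_eq_zero {A : Matrix n n ℂ} (hA : A.IsHermitian)
    (h : hermOpNorm A = 0) : A = 0 := by
  rw [← hA.eigenvalues_eq_zero_iff]
  funext i
  rw [hermOpNorm, dif_pos hA] at h
  have h1 : |hA.eigenvalues i| ≤ ⨆ i, |hA.eigenvalues i| :=
    le_ciSup (f := fun i => |hA.eigenvalues i|) (Set.finite_range _).bddAbove i
  simpa using h1.trans h.le

theorem minEig_pos [Nonempty n] {A : Matrix n n ℂ} (hA : A.PosDef) : 0 < minEig A := by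
  rw [minEig, dif_pos hA.isHermitian]
  obtain ⟨i, hi⟩ := exists_eq_ciInf_of_finite (f := hA.isHermitian.eigenvalues)
  rw [← hi]
  exact hA.eigenvalues_pos i

theorem IsDensity.posSemidef_one_sub {A : Matrix n n ℂ} (hA : IsDensity A) :
    (1 - A).PosSemidef := by
  have hH := hA.1.isHermitian
  have hsum : ∑ i, hH.eigenvalues i = 1 := by
    have h := hH.trace_eq_sum_eigenvalues
    rw [hA.2] at h
    exact_mod_cast congrArg Complex.re h.symm
  have h := posSemidef_smul_one_add_smul hH (x := 1) (y := -1) fun i => by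
    have h1 : hH.eigenvalues i ≤ ∑ j, hH.eigenvalues j :=
      Finset.single_le_sum (fun j _ => hA.1.eigenvalues_nonneg j) (Finset.mem_univ i)
    linarith
  convert h using 1
  push_cast
  module

end PosSemidefBounds

section Channels

variable {a b : Type} [Fintype a] [Fintype b]

theorem IsCP.add {Φ Ψ : Matrix a a ℂ → Matrix b b ℂ} (hΦ : IsCP Φ) (hΨ : IsCP Ψ) :
    IsCP fun A => Φ A + Ψ A := fun m _ M hM => (hΦ m M hM).add (hΨ m M hM)

theorem isCP_smul_submatrix (c : ℝ) (hc : 0 ≤ c) (f : b → a) :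
    IsCP fun A : Matrix a a ℂ => (c : ℂ) • A.submatrix f f := by
  intro m _ M hM
  exact (hM.submatrix (Prod.map id f)).smul (Complex.zero_le_real.2 hc)

/-- Measuring in the computational basis and preparing `T i` on outcome `i`
is completely positive. -/
theorem isCP_measurePrepare (T : a → Matrix b b ℂ) (hT : ∀ i, (T i).PosSemidef) :
    IsCP fun A : Matrix a a ℂ => ∑ i, A i i • T i := by
  intro m _ M hM
  have h : cpExt (fun A : Matrix a a ℂ => ∑ i, A i i • T i) m M
      = ∑ i, (M.submatrix (fun k => (k, i)) (fun k => (k, i))) ⊗ₖ T i := by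
    ext p q
    simp [cpExt, Matrix.sum_apply, Matrix.kroneckerMap_apply]
  rw [h]
  exact Matrix.posSemidef_sum _ fun i _ => (hM.submatrix _).kronecker (hT i)

theorem isCPTP_measurePrepare (T : a → Matrix b b ℂ) (hT : ∀ i, IsDensity (T i)) :
    IsCPTP fun A : Matrix a a ℂ => ∑ i, A i i • T i := by
  refine ⟨fun c A B => ?_, isCP_measurePrepare T fun i => (hT i).1, fun A => ?_⟩
  · simp [add_smul, Finset.sum_add_distrib, Finset.smul_sum, mul_smul]
  · simp only [Matrix.trace_sum, Matrix.trace_smul, (hT _).2, smul_eq_mul, mul_one]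
    rfl

/-- With probability `c` keep the first tensor factor and otherwise prepare `T₀`, if the
second factor is found in state `0`; prepare `T₁` if it is found in state `1`. -/
theorem isCPTP_controlledPrepare {c : ℝ} (hc : 0 ≤ c) {T₀ T₁ : Matrix b b ℂ}
    (h₀ : T₀.PosSemidef) (htr : T₀.trace = 1 - c) (h₁ : IsDensity T₁) :
    IsCPTP fun A : Matrix (b × Fin 2) (b × Fin 2) ℂ =>
      (c : ℂ) • A.submatrix (fun k => (k, 0)) (fun k => (k, 0))
        + ∑ p : b × Fin 2, A p p • (![T₀, T₁] : Fin 2 → Matrix b b ℂ) p.2 := by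
  refine ⟨fun z A B => ?_, (isCP_smul_submatrix c hc _).add (isCP_measurePrepare _ ?_),
    fun A => ?_⟩
  · ext i j
    simp [Matrix.sum_apply, add_mul, Finset.sum_add_distrib, Finset.mul_sum, mul_assoc]
    ring
  · rintro ⟨i, j⟩
    fin_cases j
    · exact h₀
    · exact h₁.1
  · have htr' : (A.submatrix (fun k => (k, (0 : Fin 2))) (fun k => (k, 0))).trace
        = ∑ i, A (i, 0) (i, 0) := rfl
    simp only [Matrix.trace_add, Matrix.trace_smul, Matrix.trace_sum, htr', smul_eq_mul,
      Fintype.sum_prod_type, Fin.sum_univ_two, Matrix.cons_val_zero, Matrix.cons_val_one,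
      htr, h₁.2]
    simp only [Matrix.trace, Matrix.diag, Fintype.sum_prod_type, Fin.sum_univ_two,
      Finset.sum_add_distrib, ← Finset.sum_mul]
    ring

end Channels

/-- The state `s|0⟩⟨0| + (1-s)|1⟩⟨1|`. -/
noncomputable def bitState (s : ℝ) : Matrix (Fin 2) (Fin 2) ℂ :=
  Matrix.diagonal ![(s : ℂ), 1 - s]

theorem isDensity_bitState {s : ℝ} (h0 : 0 ≤ s) (h1 : s ≤ 1) : IsDensity (bitState s) := by
  refine ⟨Matrix.PosSemidef.diagonal fun i => ?_, ?_⟩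
  · fin_cases i
    · simpa using h0
    · simpa using Complex.real_le_real.2 h1
  · simp [bitState, Matrix.trace_diagonal]

theorem IsDensity.kronecker {a b : Type} [Fintype a] [Fintype b] {A : Matrix a a ℂ}
    {B : Matrix b b ℂ} (hA : IsDensity A) (hB : IsDensity B) : IsDensity (A ⊗ₖ B) :=
  ⟨hA.1.kronecker hB.1, by rw [Matrix.trace_kronecker, hA.2, hB.2, one_mul]⟩

/-- The axioms of a quantum relative entropy: data processing, additivity and normalization. -/
structure IsRelativeEntropy
    (D : ∀ (m : Type) [Fintype m] [DecidableEq m], Matrix m m ℂ → Matrix m m ℂ → ℝ≥0∞) :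
    Prop where
  dpi : ∀ (a b : Type) [Fintype a] [DecidableEq a] [Fintype b] [DecidableEq b]
    (Φ : Matrix a a ℂ → Matrix b b ℂ), IsCPTP Φ →
    ∀ ρ σ : Matrix a a ℂ, IsDensity ρ → IsDensity σ → D b (Φ ρ) (Φ σ) ≤ D a ρ σ
  tensor : ∀ (a b : Type) [Fintype a] [DecidableEq a] [Fintype b] [DecidableEq b]
    (ρ₁ σ₁ : Matrix a a ℂ) (ρ₂ σ₂ : Matrix b b ℂ),
    IsDensity ρ₁ → IsDensity σ₁ → IsDensity ρ₂ → IsDensity σ₂ →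
    D (a × b) (ρ₁ ⊗ₖ ρ₂) (σ₁ ⊗ₖ σ₂) = D a ρ₁ σ₁ + D b ρ₂ σ₂
  norm : D (Fin 2) (Matrix.diagonal ![1, 0]) (Matrix.diagonal ![1/2, 1/2]) = 1

namespace IsRelativeEntropy

variable {D : ∀ (m : Type) [Fintype m] [DecidableEq m], Matrix m m ℂ → Matrix m m ℂ → ℝ≥0∞}

/-- If `s φ ≤ ψ` then `(φ, ψ)` is obtained by a channel from `(|0⟩⟨0|, s|0⟩⟨0| + (1-s)|1⟩⟨1|)`. -/
theorem le_bitState_of_posSemidef_sub (hD : IsRelativeEntropy D)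
    {b : Type} [Fintype b] [DecidableEq b]
    {φ ψ : Matrix b b ℂ} (hφ : IsDensity φ) (hψ : IsDensity ψ) {s : ℝ} (h0 : 0 ≤ s) (h1 : s ≤ 1)
    (h : (ψ - (s : ℂ) • φ).PosSemidef) :
    D b φ ψ ≤ D (Fin 2) (bitState 1) (bitState s) := by
  obtain ⟨T, hT, hTeq⟩ : ∃ T, IsDensity T ∧ (s : ℂ) • φ + (1 - (s : ℂ)) • T = ψ := by
    rcases h1.eq_or_lt with rfl | hlt
    · refine ⟨φ, hφ, ?_⟩
      have h2 := (h.trace_eq_zero_iff).1 (by simp [hφ.2, hψ.2])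
      rw [sub_eq_zero] at h2
      simp [h2]
    · have hne : (1 - (s : ℂ)) ≠ 0 := by
        rw [sub_ne_zero]; exact_mod_cast hlt.ne'
      refine ⟨(1 - (s : ℂ))⁻¹ • (ψ - (s : ℂ) • φ), ⟨h.smul ?_, ?_⟩, ?_⟩
      · have : (0 : ℝ) ≤ (1 - s)⁻¹ := inv_nonneg.2 (by linarith)
        exact_mod_cast Complex.zero_le_real.2 this
      · simp [hφ.2, hψ.2, hne]
      · rw [smul_inv_smul₀ hne]; abel
  have key := hD.dpi _ _ _ (isCPTP_measurePrepare ![φ, T] (by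
      intro i; fin_cases i <;> assumption)) (bitState 1) (bitState s)
      (isDensity_bitState zero_le_one le_rfl) (isDensity_bitState h0 h1)
  simp only [Fin.sum_univ_two, Matrix.cons_val_zero, Matrix.cons_val_one] at key
  refine le_trans (le_of_eq ?_) key
  congr 1
  · simp [bitState]
  · simp [bitState, ← hTeq]

theorem bitState_anti (hD : IsRelativeEntropy D) {s t : ℝ} (h0 : 0 ≤ s) (hst : s ≤ t)
    (h1 : t ≤ 1) :
    D (Fin 2) (bitState 1) (bitState t) ≤ D (Fin 2) (bitState 1) (bitState s) := by
  refine hD.le_bitState_of_posSemidef_sub (isDensity_bitState zero_le_one le_rfl)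
    (isDensity_bitState (h0.trans hst) h1) h0 (hst.trans h1) ?_
  have : bitState t - (s : ℂ) • bitState 1
      = Matrix.diagonal ![((t - s : ℝ) : ℂ), ((1 - t : ℝ) : ℂ)] := by
    ext i j
    fin_cases i <;> fin_cases j <;> simp [bitState]
  rw [this]
  refine Matrix.PosSemidef.diagonal fun i => ?_
  fin_cases i
  · exact Complex.zero_le_real.2 (sub_nonneg.2 hst)
  · exact Complex.zero_le_real.2 (sub_nonneg.2 h1)

theorem bitState_mul (hD : IsRelativeEntropy D) {s t : ℝ} (hs0 : 0 ≤ s) (hs1 : s ≤ 1)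
    (ht0 : 0 ≤ t) (ht1 : t ≤ 1) :
    D (Fin 2) (bitState 1) (bitState (s * t))
      = D (Fin 2) (bitState 1) (bitState s) + D (Fin 2) (bitState 1) (bitState t) := by
  have hd1 := isDensity_bitState zero_le_one le_rfl
  have hds := isDensity_bitState hs0 hs1
  have hdt := isDensity_bitState ht0 ht1
  have hd0 := isDensity_bitState le_rfl zero_le_one
  rw [← hD.tensor _ _ _ _ _ _ hd1 hds hd1 hdt]
  refine le_antisymm ?_ ?_
  · have key := hD.dpi _ _ _ (isCPTP_measurePrepare
      (fun p : Fin 2 × Fin 2 => if p = (0, 0) then bitState 1 else bitState 0) (by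
        intro i; split_ifs <;> assumption)) _ _ (hd1.kronecker hd1) (hds.kronecker hdt)
    refine le_trans (le_of_eq ?_) key
    congr 1
    · ext i j
      fin_cases i <;> fin_cases j <;>
        simp [Fintype.sum_prod_type, Fin.sum_univ_two, bitState]
    · ext i j
      fin_cases i <;> fin_cases j <;>
        simp [Fintype.sum_prod_type, Fin.sum_univ_two, bitState]
      ring
  · refine hD.le_bitState_of_posSemidef_sub (hd1.kronecker hd1) (hds.kronecker hdt)
      (mul_nonneg hs0 ht0) (mul_le_one₀ hs1 ht0 ht1) ?_
    have : bitState s ⊗ₖ bitState t - ((s * t : ℝ) : ℂ) • (bitState 1 ⊗ₖ bitState 1)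
        = Matrix.diagonal fun p : Fin 2 × Fin 2 => (((![![0, s * (1 - t)],
            ![(1 - s) * t, (1 - s) * (1 - t)]] : Fin 2 → Fin 2 → ℝ) p.1 p.2 : ℝ) : ℂ) := by
      ext ⟨i₁, i₂⟩ ⟨j₁, j₂⟩
      fin_cases i₁ <;> fin_cases i₂ <;> fin_cases j₁ <;> fin_cases j₂ <;> simp [bitState]
    rw [this]
    refine Matrix.PosSemidef.diagonal fun p => Complex.zero_le_real.2 ?_
    have hs' := sub_nonneg.2 hs1
    have ht' := sub_nonneg.2 ht1
    obtain ⟨i, j⟩ := p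
    fin_cases i <;> fin_cases j <;> simp <;> positivity

theorem bitState_half (hD : IsRelativeEntropy D) :
    D (Fin 2) (bitState 1) (bitState (1 / 2)) = 1 := by
  rw [← hD.norm]
  congr 1 <;> ext i j <;> fin_cases i <;> fin_cases j <;> norm_num [bitState]

theorem bitState_pow (hD : IsRelativeEntropy D) {s : ℝ} (h0 : 0 ≤ s) (h1 : s ≤ 1) (k : ℕ) :
    D (Fin 2) (bitState 1) (bitState (s ^ k)) = k * D (Fin 2) (bitState 1) (bitState s) := by
  induction k with
  | zero =>
    have hle : D (Fin 2) (bitState 1) (bitState 1) ≤ 1 :=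
      hD.bitState_half ▸ hD.bitState_anti (by norm_num) (by norm_num) le_rfl
    have hmul := hD.bitState_mul zero_le_one le_rfl zero_le_one le_rfl
    have hfin : D (Fin 2) (bitState 1) (bitState 1) ≠ ∞ := (hle.trans_lt ENNReal.one_lt_top).ne
    rw [mul_one] at hmul
    simpa using (ENNReal.add_right_inj hfin).1 (hmul.symm.trans (add_zero _).symm)
  | succ k ih =>
    rw [pow_succ, hD.bitState_mul (pow_nonneg h0 k) (pow_le_one₀ h0 h1) h0 h1, ih]
    push_cast
    ring

theorem bitState_le (hD : IsRelativeEntropy D) {s : ℝ} (h0 : 0 < s) (h1 : s ≤ 1) :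
    D (Fin 2) (bitState 1) (bitState s) ≤ ENNReal.ofReal (-Real.logb 2 s) := by
  set x : ℝ := -Real.logb 2 s with hx
  have hx0 : 0 ≤ x := neg_nonneg.2 (Real.logb_nonpos one_lt_two h0.le h1)
  have hhalf := hD.bitState_half
  have hbound : ∀ n : ℕ, n * D (Fin 2) (bitState 1) (bitState s) ≤ (⌈n * x⌉₊ : ℕ) := by
    intro n
    rw [← hD.bitState_pow h0.le h1]
    calc _ ≤ D (Fin 2) (bitState 1) (bitState ((1 / 2) ^ ⌈n * x⌉₊)) := by
          refine hD.bitState_anti (by positivity) ?_ (pow_le_one₀ h0.le h1)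
          rw [← Real.logb_le_logb (b := 2) one_lt_two (by positivity) (by positivity),
            Real.logb_pow, Real.logb_pow, one_div, Real.logb_inv,
            Real.logb_self_eq_one one_lt_two]
          have := Nat.le_ceil (n * x)
          rw [hx] at this ⊢
          linarith
      _ = _ := by
          rw [hD.bitState_pow (by norm_num) (by norm_num), hhalf, mul_one]
  have hfin : D (Fin 2) (bitState 1) (bitState s) ≠ ∞ := by
    have := hbound 1
    rw [Nat.cast_one, one_mul] at this
    exact (this.trans_lt (ENNReal.natCast_lt_top _)).ne
  rw [ENNReal.le_ofReal_iff_toReal_le hfin hx0]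
  set y := (D (Fin 2) (bitState 1) (bitState s)).toReal with hy
  have hreal : ∀ n : ℕ, n * y ≤ n * x + 1 := by
    intro n
    have h2 := ENNReal.toReal_mono (ENNReal.natCast_ne_top _) (hbound n)
    rw [ENNReal.toReal_mul, ENNReal.toReal_natCast, ENNReal.toReal_natCast] at h2
    exact h2.trans (Nat.ceil_lt_add_one (by positivity)).le
  by_contra! hlt
  obtain ⟨n, hn⟩ := exists_nat_gt (1 / (y - x))
  rw [div_lt_iff₀ (sub_pos.2 hlt)] at hn
  linarith [hreal n]

/-- If the channel `X ↦ c X + Tr(X) T` sends `ω` to `ρ` and `σ` to at most `s⁻¹ σ`, then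
`𝐃(ρ‖σ) ≤ 𝐃(ω‖σ) - log₂ s`. -/
theorem le_add_of_partialReplacement (hD : IsRelativeEntropy D)
    {b : Type} [Fintype b] [DecidableEq b]
    {ω σ T : Matrix b b ℂ} (hω : IsDensity ω) (hσ : IsDensity σ) (hT : T.PosSemidef)
    {c s : ℝ} (hc : 0 ≤ c) (htr : T.trace = 1 - c) (h0 : 0 < s) (h1 : s < 1)
    (h : (σ - (s : ℂ) • ((c : ℂ) • σ + T)).PosSemidef) :
    D b ((c : ℂ) • ω + T) σ ≤ D b ω σ + ENNReal.ofReal (-Real.logb 2 s) := by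
  have hne : (1 - (s : ℂ)) ≠ 0 := by
    rw [sub_ne_zero]; exact_mod_cast h1.ne'
  have hT₁ : IsDensity ((1 - (s : ℂ))⁻¹ • (σ - (s : ℂ) • ((c : ℂ) • σ + T))) := by
    refine ⟨h.smul ?_, ?_⟩
    · have : (0 : ℝ) ≤ (1 - s)⁻¹ := inv_nonneg.2 (by linarith)
      exact_mod_cast Complex.zero_le_real.2 this
    · simp only [Matrix.trace_smul, Matrix.trace_sub, Matrix.trace_add, hσ.2, htr, smul_eq_mul]
      field_simp
      ring
  have hd1 := isDensity_bitState zero_le_one le_rfl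
  have hds := isDensity_bitState h0.le h1.le
  have key := hD.dpi _ _ _ (isCPTP_controlledPrepare hc hT htr hT₁) _ _
    (hω.kronecker hd1) (hσ.kronecker hds)
  rw [hD.tensor _ _ _ _ _ _ hω hσ hd1 hds] at key
  refine le_trans (le_of_eq ?_)
    (key.trans (add_le_add_right (hD.bitState_le h0 h1.le) _))
  have hsub : ∀ (A : Matrix b b ℂ) (u : ℝ),
      (A ⊗ₖ bitState u).submatrix (fun k => (k, (0 : Fin 2))) (fun k => (k, 0))
        = (u : ℂ) • A := by
    intro A u
    ext i j
    simp [bitState, mul_comm]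
  have hsum : ∀ (A T₁ : Matrix b b ℂ) (u : ℝ), A.trace = 1 →
      ∑ p : b × Fin 2, (A ⊗ₖ bitState u) p p • (![T, T₁] : Fin 2 → Matrix b b ℂ) p.2
        = (u : ℂ) • T + (1 - (u : ℂ)) • T₁ := by
    intro A T₁ u hA
    simp only [Fintype.sum_prod_type, Fin.sum_univ_two, Finset.sum_add_distrib]
    simp only [Matrix.kroneckerMap_apply, bitState, Matrix.diagonal_apply_eq,
      Matrix.cons_val_zero, Matrix.cons_val_one, ← Finset.sum_smul, ← Finset.sum_mul]
    have : ∑ i, A i i = 1 := hA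
    rw [this, one_mul, one_mul]
  simp only [hsub, hsum _ _ _ hω.2, hsum _ _ _ hσ.2]
  congr 1
  · simp
  · rw [smul_inv_smul₀ hne]
    module

end IsRelativeEntropy

/-- Continuity in the first argument: if `σ > 0` and `λ_min(ω) > ‖ρ - ω‖_∞` then any
quantum relative entropy satisfies
`𝐃(ρ‖σ) ≤ 𝐃(ω‖σ) + log₂(1 + ‖ρ-ω‖_∞/(λ_min(ω)·λ_min(σ)))`. -/
theorem stmt9
    (D : ∀ (m : Type) [Fintype m] [DecidableEq m],
      Matrix m m ℂ → Matrix m m ℂ → ℝ≥0∞)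
    -- data-processing inequality under quantum channels
    (hdpi : ∀ (a b : Type) [Fintype a] [DecidableEq a] [Fintype b] [DecidableEq b]
      (Φ : Matrix a a ℂ → Matrix b b ℂ), IsCPTP Φ →
      ∀ ρ σ : Matrix a a ℂ, IsDensity ρ → IsDensity σ → D b (Φ ρ) (Φ σ) ≤ D a ρ σ)
    -- additivity under tensor products
    (hadd : ∀ (a b : Type) [Fintype a] [DecidableEq a] [Fintype b] [DecidableEq b]
      (ρ₁ σ₁ : Matrix a a ℂ) (ρ₂ σ₂ : Matrix b b ℂ),
      IsDensity ρ₁ → IsDensity σ₁ → IsDensity ρ₂ → IsDensity σ₂ →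
      D (a × b) (ρ₁ ⊗ₖ ρ₂) (σ₁ ⊗ₖ σ₂) = D a ρ₁ σ₁ + D b ρ₂ σ₂)
    -- normalization
    (hnorm : D (Fin 2) (Matrix.diagonal ![1, 0]) (Matrix.diagonal ![1/2, 1/2]) = 1)
    (d : ℕ) (hd : 0 < d) (ρ ω σ : Matrix (Fin d) (Fin d) ℂ)
    (hρ : IsDensity ρ) (hω : IsDensity ω) (hσ : IsDensity σ)
    (hσpos : σ.PosDef)
    (hgap : hermOpNorm (ρ - ω) < minEig ω) :
    D (Fin d) ρ σ ≤ D (Fin d) ω σ +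
      ENNReal.ofReal (Real.logb 2 (1 + hermOpNorm (ρ - ω) / (minEig ω * minEig σ))) := by
  have : Nonempty (Fin d) := ⟨⟨0, hd⟩⟩
  have hX : (ρ - ω).IsHermitian := hρ.1.isHermitian.sub hω.1.isHermitian
  set ε := hermOpNorm (ρ - ω) with hε
  set l := minEig ω with hl
  set μ := minEig σ with hμ
  have hμ0 : 0 < μ := minEig_pos hσpos
  rcases (hermOpNorm_nonneg (ρ - ω)).eq_or_lt with h0 | hε0
  · rw [sub_eq_zero.1 (eq_zero_of_hermOpNorm_eq_zero hX h0.symm)]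
    exact le_self_add
  rw [← hε] at hε0
  have hl0 : 0 < l := hε0.trans hgap
  obtain ⟨δ, hδ⟩ : ∃ δ : ℝ, δ = ε / l := ⟨_, rfl⟩
  have hδ0 : 0 < δ := hδ ▸ div_pos hε0 hl0
  have hδ1 : δ < 1 := by rw [hδ, div_lt_one hl0]; exact hgap
  have hδl : δ * l = ε := by rw [hδ]; field_simp
  have hδC : (δ : ℂ) ≠ 0 := by exact_mod_cast hδ0.ne'
  have hμC : (μ : ℂ) ≠ 0 := by exact_mod_cast hμ0.ne'
  set T : Matrix (Fin d) (Fin d) ℂ := ρ - ((1 - δ : ℝ) : ℂ) • ω with hT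
  have hTpos : T.PosSemidef := by
    have h := (posSemidef_add_hermOpNorm hX).add
      ((posSemidef_sub_minEig hω.1.isHermitian).smul (Complex.zero_le_real.2 hδ0.le))
    convert h using 1
    rw [hT, ← hε, ← hl, ← hδl]
    push_cast
    module
  have hTtr : T.trace = 1 - ((1 - δ : ℝ) : ℂ) := by
    simp [hT, hρ.2, hω.2]
  have hTle : ((δ : ℂ) • (1 : Matrix (Fin d) (Fin d) ℂ) - T).PosSemidef := by
    have hτ : IsDensity ((δ : ℂ)⁻¹ • T) := by
      refine ⟨hTpos.smul ?_, ?_⟩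
      · exact_mod_cast Complex.zero_le_real.2 (inv_nonneg.2 hδ0.le)
      · simp [hTtr, hδC]
    have h := hτ.posSemidef_one_sub.smul (Complex.zero_le_real.2 hδ0.le)
    rwa [smul_sub, smul_inv_smul₀ hδC] at h
  have hr : 1 < 1 + δ / μ := by linarith [div_pos hδ0 hμ0]
  have hrC : (1 + δ / μ : ℂ) ≠ 0 := by exact_mod_cast (zero_lt_one.trans hr).ne'
  have hmain := IsRelativeEntropy.le_add_of_partialReplacement ⟨hdpi, hadd, hnorm⟩ hω hσ hTpos
    (c := 1 - δ) (s := (1 + δ / μ)⁻¹) (by linarith) hTtr (by positivity) (inv_lt_one_of_one_lt₀ hr)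
    (by
      have h := (((posSemidef_sub_minEig hσ.1.isHermitian).smul
        (Complex.zero_le_real.2 (div_pos hδ0 hμ0).le)).add
        ((hσ.1.smul (Complex.zero_le_real.2 hδ0.le)).add hTle)).smul
        (Complex.zero_le_real.2 (inv_nonneg.2 (zero_lt_one.trans hr).le))
      convert h using 1
      rw [← hμ]
      have h1 : σ = ((1 + δ / μ : ℂ)⁻¹ * (1 + δ / μ : ℂ)) • σ := by
        rw [inv_mul_cancel₀ hrC, one_smul]
      have h2 : (δ : ℂ) • (1 : Matrix (Fin d) (Fin d) ℂ) = ((δ / μ : ℂ) * μ) • 1 := by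
        rw [div_mul_cancel₀ _ hμC]
      rw [h2]
      nth_rewrite 1 [h1]
      push_cast
      module)
  have hρeq : ((1 - δ : ℝ) : ℂ) • ω + T = ρ := by rw [hT]; abel
  rw [hρeq, Real.logb_inv, neg_neg, hδ, div_div] at hmain
  exact hmain
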